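/- arXiv:2512.10292 — 5 statements merged into one kernel-verified Lean document; each statement's English description precedes it below -/
import Mathlib

section
/- Let G be an n-player polynomial game over a compact basic semialgebraic set X ⊆ ℝ^m whose quadratic module Q(X) is Archimedean, with symmetrized Jacobian SJ(x), and set M* = max_{x ∈ X, yᵀy = 1} yᵀ SJ(x) y. Then the hierarchy values Λ_ℓ(G) = inf{λ ∈ ℝ : λ − yᵀ SJ(x) y ∈ Q_ℓ(X × B)} converge to M* as ℓ → ∞: for every ε > 0 there exists ℓ_0 such that M* ≤ Λ_ℓ(G) ≤ M* + ε for all ℓ ≥ ℓ_0. -/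
open MvPolynomial Finset

noncomputable section

/-- `p` is a sum of squares of polynomials. -/
def IsSOS {σ : Type*} (p : MvPolynomial σ ℝ) : Prop :=
  ∃ (k : ℕ) (q : Fin k → MvPolynomial σ ℝ), p = ∑ i, q i ^ 2

/-- Membership in the quadratic module generated by the inequality polynomials `g`
and the equality polynomials `h`. -/
def InQM {σ ιg ιh : Type*} [Fintype ιg] [Fintype ιh]
    (g : ιg → MvPolynomial σ ℝ) (h : ιh → MvPolynomial σ ℝ)
    (p : MvPolynomial σ ℝ) : Prop :=
  ∃ (s0 : MvPolynomial σ ℝ) (s : ιg → MvPolynomial σ ℝ) (q : ιh → MvPolynomial σ ℝ),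
    IsSOS s0 ∧ (∀ j, IsSOS (s j)) ∧
      p = s0 + ∑ j, g j * s j + ∑ j, h j * q j

/-- Membership in the degree-`ℓ` truncation of the quadratic module: all the SOS
multipliers and the polynomial multipliers have degree at most `ℓ`. -/
def InQMdeg {σ ιg ιh : Type*} [Fintype ιg] [Fintype ιh]
    (ℓ : ℕ) (g : ιg → MvPolynomial σ ℝ) (h : ιh → MvPolynomial σ ℝ)
    (p : MvPolynomial σ ℝ) : Prop :=
  ∃ (s0 : MvPolynomial σ ℝ) (s : ιg → MvPolynomial σ ℝ) (q : ιh → MvPolynomial σ ℝ),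
    IsSOS s0 ∧ (∀ j, IsSOS (s j)) ∧
      s0.totalDegree ≤ ℓ ∧ (∀ j, (s j).totalDegree ≤ ℓ) ∧ (∀ j, (q j).totalDegree ≤ ℓ) ∧
      p = s0 + ∑ j, g j * s j + ∑ j, h j * q j

/-- The basic semialgebraic set `{x | g j x ≥ 0 for all j, h j x = 0 for all j}`. -/
def semialgSet {m : ℕ} {ιg ιh : Type*} (g : ιg → MvPolynomial (Fin m) ℝ)
    (h : ιh → MvPolynomial (Fin m) ℝ) : Set (Fin m → ℝ) :=
  {x | (∀ j, 0 ≤ eval x (g j)) ∧ ∀ j, eval x (h j) = 0}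
/-- The `j`-th component of the pseudogradient of the game with payoffs `u`, where the
variable `j` belongs to player `π j`. -/
def pseudoGrad {m n : ℕ} (π : Fin m → Fin n) (u : Fin n → MvPolynomial (Fin m) ℝ)
    (j : Fin m) : MvPolynomial (Fin m) ℝ :=
  pderiv j (u (π j))

/-- Entry `(j, k)` of the symmetrized Jacobian `SJ = (J + Jᵀ)/2` of the pseudogradient. -/
def sjac {m n : ℕ} (π : Fin m → Fin n) (u : Fin n → MvPolynomial (Fin m) ℝ)
    (j k : Fin m) : MvPolynomial (Fin m) ℝ :=
  C (1 / 2 : ℝ) * (pderiv k (pseudoGrad π u j) + pderiv j (pseudoGrad π u k))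

/-- The quadratic form `yᵀ SJ(x) y` of the symmetrized Jacobian. -/
def sjForm {m n : ℕ} (π : Fin m → Fin n) (u : Fin n → MvPolynomial (Fin m) ℝ)
    (x y : Fin m → ℝ) : ℝ :=
  ∑ j, ∑ k, y j * y k * eval x (sjac π u j k)
/-- The inequality polynomials of `X`, viewed as polynomials in the variables `(x, y)`. -/
def liftIneq {m : ℕ} {ιg : Type*} (τ : Type*) (g : ιg → MvPolynomial (Fin m) ℝ) :
    ιg → MvPolynomial (Fin m ⊕ τ) ℝ :=
  fun j => rename Sum.inl (g j)

/-- The equality polynomials of `X` together with `1 - yᵀy`, viewed as polynomials in the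
variables `(x, y)`; together with `liftIneq` these define `X × B`. -/
def liftEq {m : ℕ} {ιh : Type*} (τ : Type*) [Fintype τ] (h : ιh → MvPolynomial (Fin m) ℝ) :
    ιh ⊕ Unit → MvPolynomial (Fin m ⊕ τ) ℝ :=
  Sum.elim (fun j => rename Sum.inl (h j)) (fun _ => 1 - ∑ t : τ, X (Sum.inr t) ^ 2)

/-- The polynomial `yᵀ SJ(x) y` in the variables `(x, y)`. -/
def sjFormPoly {m n : ℕ} (π : Fin m → Fin n) (u : Fin n → MvPolynomial (Fin m) ℝ) :
    MvPolynomial (Fin m ⊕ Fin m) ℝ :=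
  ∑ j, ∑ k, X (Sum.inr j) * X (Sum.inr k) * rename Sum.inl (sjac π u j k)
/-- The value `Λ_ℓ(G) = inf {λ ∈ ℝ | λ - yᵀ SJ(x) y ∈ Q_ℓ(X × B)}` of the `ℓ`-th level of
the SOS hierarchy, taken in `EReal` so that `inf ∅ = +∞`. -/
def LambdaVal {m n mg mh : ℕ} (π : Fin m → Fin n) (u : Fin n → MvPolynomial (Fin m) ℝ)
    (g : Fin mg → MvPolynomial (Fin m) ℝ) (h : Fin mh → MvPolynomial (Fin m) ℝ)
    (ℓ : ℕ) : EReal :=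
  sInf {r : EReal | ∃ lam : ℝ, r = (lam : EReal) ∧
    InQMdeg ℓ (liftIneq (Fin m) g) (liftEq (Fin m) h) (C lam - sjFormPoly π u)}

/-- A subset of a commutative ring that contains `1` and is closed under addition and under
multiplication by squares. -/
structure IsQuadModule {A : Type*} [CommRing A] (P : Set A) : Prop where
  one_mem : (1 : A) ∈ P
  add_mem : ∀ {a b : A}, a ∈ P → b ∈ P → a + b ∈ P
  sq_mul_mem : ∀ (a : A) {b : A}, b ∈ P → a ^ 2 * b ∈ P

namespace IsQuadModule

variable {A : Type*} [CommRing A] {P : Set A}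

lemma zero_mem (hP : IsQuadModule P) : (0 : A) ∈ P := by
  simpa using hP.sq_mul_mem 0 hP.one_mem

lemma isSumSq_mul_mem (hP : IsQuadModule P) {s b : A} (hs : IsSumSq s) (hb : b ∈ P) :
    s * b ∈ P := by
  induction hs with
  | zero => simpa using hP.zero_mem
  | sq_add a _ ih =>
    rw [add_mul, ← sq]
    exact hP.add_mem (hP.sq_mul_mem a hb) ih

lemma isSumSq_mem (hP : IsQuadModule P) {s : A} (hs : IsSumSq s) : s ∈ P := by
  simpa using hP.isSumSq_mul_mem hs hP.one_mem

lemma sq_mem (hP : IsQuadModule P) (a : A) : a ^ 2 ∈ P := by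
  simpa using hP.sq_mul_mem a hP.one_mem

/-- The quadratic module generated by `P` and one further element `a`. -/
lemma adjoin (hP : IsQuadModule P) (a : A) :
    IsQuadModule {x | ∃ p ∈ P, ∃ s : A, IsSumSq s ∧ x = p + s * a} where
  one_mem := ⟨1, hP.one_mem, 0, .zero, by ring⟩
  add_mem := by
    rintro _ _ ⟨p, hp, s, hs, rfl⟩ ⟨q, hq, t, ht, rfl⟩
    exact ⟨p + q, hP.add_mem hp hq, s + t, hs.add ht, by ring⟩
  sq_mul_mem := by
    rintro b _ ⟨p, hp, s, hs, rfl⟩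
    refine ⟨b ^ 2 * p, hP.sq_mul_mem b hp, b ^ 2 * s, ?_, by ring⟩
    rw [sq]
    exact (IsSumSq.mul_self b).mul hs

lemma exists_maximal (hP : IsQuadModule P) (h1 : (-1 : A) ∉ P) :
    ∃ M, P ⊆ M ∧ Maximal (fun S : Set A => IsQuadModule S ∧ (-1 : A) ∉ S) M := by
  refine zorn_subset_nonempty {S : Set A | IsQuadModule S ∧ (-1 : A) ∉ S} ?_ P ⟨hP, h1⟩
  intro c hc hchain hne
  refine ⟨⋃₀ c, ⟨⟨?_, ?_, ?_⟩, ?_⟩, fun s hs => Set.subset_sUnion_of_mem hs⟩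
  · obtain ⟨S, hS⟩ := hne
    exact ⟨S, hS, (hc hS).1.one_mem⟩
  · rintro a b ⟨S, hS, ha⟩ ⟨T, hT, hb⟩
    rcases hchain.total hS hT with h | h
    · exact ⟨T, hT, (hc hT).1.add_mem (h ha) hb⟩
    · exact ⟨S, hS, (hc hS).1.add_mem ha (h hb)⟩
  · rintro a b ⟨S, hS, hb⟩
    exact ⟨S, hS, (hc hS).1.sq_mul_mem a hb⟩
  · rintro ⟨S, hS, h⟩
    exact (hc hS).2 h

variable [Algebra ℝ A]

lemma algebraMap_mul_mem (hP : IsQuadModule P) {c : ℝ} (hc : 0 ≤ c) {b : A} (hb : b ∈ P) :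
    algebraMap ℝ A c * b ∈ P := by
  have := hP.sq_mul_mem (algebraMap ℝ A (√c)) hb
  rwa [← map_pow, Real.sq_sqrt hc] at this

lemma algebraMap_mem (hP : IsQuadModule P) {c : ℝ} (hc : 0 ≤ c) : algebraMap ℝ A c ∈ P := by
  simpa using hP.algebraMap_mul_mem hc hP.one_mem

lemma mem_of_algebraMap_mul_mem (hP : IsQuadModule P) {c : ℝ} (hc : 0 < c) {b : A}
    (hb : algebraMap ℝ A c * b ∈ P) : b ∈ P := by
  have := hP.algebraMap_mul_mem (inv_nonneg.2 hc.le) hb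
  rwa [← mul_assoc, ← map_mul, inv_mul_cancel₀ hc.ne', map_one, one_mul] at this

lemma nonneg_of_algebraMap_mem (hP : IsQuadModule P) (h1 : (-1 : A) ∉ P) {c : ℝ}
    (hc : algebraMap ℝ A c ∈ P) : 0 ≤ c := by
  by_contra! h
  refine h1 (hP.mem_of_algebraMap_mul_mem (neg_pos.2 h) ?_)
  simpa using hc

/-- The support `P ∩ -P` absorbs multiplication. -/
lemma mul_mem_of_neg_mem (hP : IsQuadModule P) {b : A} (hb : b ∈ P) (hb' : -b ∈ P) (a : A) :
    a * b ∈ P := by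
  refine hP.mem_of_algebraMap_mul_mem (c := 4) (by norm_num) ?_
  have := hP.add_mem (hP.sq_mul_mem (a + 1) hb) (hP.sq_mul_mem (a - 1) hb')
  convert this using 1
  rw [map_ofNat]
  ring

lemma sq_sub_sq_mem (hP : IsQuadModule P) {c : ℝ} (hc : 0 < c) {a : A}
    (h₁ : algebraMap ℝ A c - a ∈ P) (h₂ : algebraMap ℝ A c + a ∈ P) :
    algebraMap ℝ A (c ^ 2) - a ^ 2 ∈ P := by
  refine hP.mem_of_algebraMap_mul_mem (c := 2 * c) (by positivity) ?_
  have := hP.add_mem (hP.sq_mul_mem (algebraMap ℝ A c - a) h₂)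
    (hP.sq_mul_mem (algebraMap ℝ A c + a) h₁)
  convert this using 1
  simp only [map_mul, map_pow, map_ofNat]
  ring

lemma mem_or_neg_mem_of_maximal
    (hP : Maximal (fun S : Set A => IsQuadModule S ∧ (-1 : A) ∉ S) P) (a : A) :
    a ∈ P ∨ -a ∈ P := by
  have hQ := hP.prop.1
  have key : ∀ b : A, b ∉ P → ∃ p ∈ P, ∃ s : A, IsSumSq s ∧ (-1 : A) = p + s * b := by
    intro b hb
    by_contra hneg
    refine hb (hP.le_of_ge ⟨hQ.adjoin b, hneg⟩ (fun p hp => ⟨p, hp, 0, .zero, by ring⟩) ?_)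
    exact ⟨0, hQ.zero_mem, 1, IsSumSq.one, by ring⟩
  by_contra! hcon
  obtain ⟨p, hp, s, hs, h₁⟩ := key a hcon.1
  obtain ⟨q, hq, t, ht, h₂⟩ := key (-a) hcon.2
  have hs' : -s ∈ P := by
    have : -s = t + (t * p + s * q) := by linear_combination t * h₁ + s * h₂
    rw [this]
    exact hQ.add_mem (hQ.isSumSq_mem ht)
      (hQ.add_mem (hQ.isSumSq_mul_mem ht hp) (hQ.isSumSq_mul_mem hs hq))
  refine hP.prop.2 ?_
  rw [h₁, mul_comm]
  exact hQ.add_mem hp (hQ.mul_mem_of_neg_mem (hQ.isSumSq_mem hs) hs' a)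

/-- A maximal proper Archimedean quadratic module is nonnegative under some real character. -/
lemma exists_algHom_of_maximal
    (hP : Maximal (fun S : Set A => IsQuadModule S ∧ (-1 : A) ∉ S) P)
    (harch : ∀ a : A, ∃ c : ℝ, algebraMap ℝ A c - a ∈ P) :
    ∃ φ : A →ₐ[ℝ] ℝ, ∀ a ∈ P, 0 ≤ φ a := by
  have hQ := hP.prop.1
  have h1 := hP.prop.2
  let small : A → Prop := fun a =>
    ∀ ε : ℝ, 0 < ε → algebraMap ℝ A ε - a ∈ P ∧ algebraMap ℝ A ε + a ∈ P
  have small_add : ∀ a b, small a → small b → small (a + b) := by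
    intro a b ha hb ε hε
    constructor
    · convert hQ.add_mem (ha (ε / 2) (by positivity)).1 (hb (ε / 2) (by positivity)).1 using 1
      rw [← add_halves ε, map_add]
      simp only [add_halves]
      ring
    · convert hQ.add_mem (ha (ε / 2) (by positivity)).2 (hb (ε / 2) (by positivity)).2 using 1
      rw [← add_halves ε, map_add]
      simp only [add_halves]
      ring
  have small_neg : ∀ a, small a → small (-a) := fun a ha ε hε =>
    ⟨by simpa using (ha ε hε).2, by simpa [sub_eq_add_neg] using (ha ε hε).1⟩
  have small_smul : ∀ (c : ℝ) a, 0 < c → small a → small (algebraMap ℝ A c * a) := by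
    intro c a hc ha ε hε
    have hmul : algebraMap ℝ A ε = algebraMap ℝ A c * algebraMap ℝ A (ε / c) := by
      rw [← map_mul, mul_div_cancel₀ _ hc.ne']
    rw [hmul, ← mul_sub, ← mul_add]
    exact ⟨hQ.algebraMap_mul_mem hc.le (ha _ (by positivity)).1,
      hQ.algebraMap_mul_mem hc.le (ha _ (by positivity)).2⟩
  have small_smul' : ∀ (c : ℝ) a, small a → small (algebraMap ℝ A c * a) := by
    intro c a ha
    rcases lt_trichotomy c 0 with hc | rfl | hc
    · simpa using small_neg _ (small_smul (-c) a (neg_pos.2 hc) ha)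
    · intro ε hε
      simpa using hQ.algebraMap_mem hε.le
    · exact small_smul c a hc ha
  have small_sq : ∀ a, small a → small (a ^ 2) := by
    intro a ha ε hε
    refine ⟨?_, hQ.add_mem (hQ.algebraMap_mem hε.le) (hQ.sq_mem a)⟩
    have h := hQ.sq_sub_sq_mem (Real.sqrt_pos.2 hε) (ha _ (Real.sqrt_pos.2 hε)).1
      (ha _ (Real.sqrt_pos.2 hε)).2
    rwa [Real.sq_sqrt hε.le] at h
  have small_const : ∀ r : ℝ, small (algebraMap ℝ A r) → r = 0 := by
    intro r hr
    by_contra hne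
    have hpos : 0 < |r| := abs_pos.2 hne
    have ha := hr (|r| / 2) (by positivity)
    rw [← map_sub, ← map_add] at ha
    have h₁ := hQ.nonneg_of_algebraMap_mem h1 ha.1
    have h₂ := hQ.nonneg_of_algebraMap_mem h1 ha.2
    rcases abs_cases r with h | h <;> linarith
  have hex : ∀ a : A, ∃ r : ℝ, small (a - algebraMap ℝ A r) := by
    intro a
    let S : Set ℝ := {r | a - algebraMap ℝ A r ∈ P}
    have hne : S.Nonempty := by
      obtain ⟨c, hc⟩ := harch (-a)
      refine ⟨-c, ?_⟩
      change a - algebraMap ℝ A (-c) ∈ P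
      convert hc using 1
      rw [map_neg]
      ring
    have hbdd : BddAbove S := by
      obtain ⟨c, hc⟩ := harch a
      refine ⟨c, fun r hr => ?_⟩
      have h := hQ.add_mem hc hr
      rw [sub_add_sub_cancel, ← map_sub] at h
      linarith [hQ.nonneg_of_algebraMap_mem h1 h]
    refine ⟨sSup S, fun ε hε => ⟨?_, ?_⟩⟩
    · have hnot : sSup S + ε ∉ S := fun h => by linarith [le_csSup hbdd h]
      have h := (mem_or_neg_mem_of_maximal hP (a - algebraMap ℝ A (sSup S + ε))).resolve_left hnot
      convert h using 1
      rw [map_add]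
      ring
    · obtain ⟨s, hs, hlt⟩ := exists_lt_of_lt_csSup hne (sub_lt_self (sSup S) hε)
      have h := hQ.add_mem hs (hQ.algebraMap_mem (A := A) (c := s - sSup S + ε) (by linarith))
      convert h using 1
      rw [map_add, map_sub]
      ring
  choose φ hφ using hex
  have huniq : ∀ a r, small (a - algebraMap ℝ A r) → φ a = r := by
    intro a r h
    have h' := small_add _ _ h (small_neg _ (hφ a))
    have : a - algebraMap ℝ A r + -(a - algebraMap ℝ A (φ a)) = algebraMap ℝ A (φ a - r) := by
      rw [map_sub]
      ring
    rw [this] at h'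
    linarith [small_const _ h']
  have φ_const : ∀ r : ℝ, φ (algebraMap ℝ A r) = r := fun r => huniq _ _ fun ε hε => by
    simpa using hQ.algebraMap_mem hε.le
  have φ_add : ∀ a b, φ (a + b) = φ a + φ b := fun a b => huniq _ _ <| by
    convert small_add _ _ (hφ a) (hφ b) using 1
    rw [map_add]
    ring
  have φ_sq : ∀ a, φ (a ^ 2) = φ a ^ 2 := fun a => huniq _ _ <| by
    convert small_add _ _ (small_sq _ (hφ a)) (small_smul' (2 * φ a) _ (hφ a)) using 1
    simp only [map_mul, map_pow, map_ofNat]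
    ring
  have φ_mul : ∀ a b, φ (a * b) = φ a * φ b := by
    intro a b
    have h := φ_sq (a + b)
    rw [show (a + b) ^ 2 = a ^ 2 + b ^ 2 + (a * b + a * b) by ring, φ_add, φ_add, φ_add, φ_add,
      φ_sq, φ_sq] at h
    linarith
  refine ⟨{ toFun := φ
            map_one' := by simpa using φ_const 1
            map_mul' := φ_mul
            map_zero' := by simpa using φ_const 0
            map_add' := φ_add
            commutes' := φ_const }, fun a ha => ?_⟩
  change 0 ≤ φ a
  refine le_of_forall_pos_le_add fun ε hε => ?_
  have h := hQ.add_mem (hφ a ε hε).1 ha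
  rw [show algebraMap ℝ A ε - (a - algebraMap ℝ A (φ a)) + a = algebraMap ℝ A (φ a + ε) by
    rw [map_add]; ring] at h
  exact hQ.nonneg_of_algebraMap_mem h1 h

/-- **Representation theorem**: an element that is positive at every real character which is
nonnegative on an Archimedean quadratic module belongs to that module. -/
theorem mem_of_forall_algHom_pos (hP : IsQuadModule P)
    (harch : ∀ a : A, ∃ c : ℝ, algebraMap ℝ A c - a ∈ P) {f : A}
    (hf : ∀ φ : A →ₐ[ℝ] ℝ, (∀ a ∈ P, 0 ≤ φ a) → 0 < φ f) : f ∈ P := by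
  obtain ⟨q, hq, s, hs, hqs⟩ : ∃ q ∈ P, ∃ s : A, IsSumSq s ∧ (-1 : A) = q + s * -f := by
    by_contra hneg
    obtain ⟨M, hPM, hM⟩ := (hP.adjoin (-f)).exists_maximal hneg
    have hP' : P ⊆ M := fun p hp => hPM ⟨p, hp, 0, .zero, by ring⟩
    obtain ⟨φ, hφ⟩ := exists_algHom_of_maximal hM fun a => (harch a).imp fun c hc => hP' hc
    have h₁ := hf φ fun a ha => hφ a (hP' ha)
    have h₂ := hφ (-f) (hPM ⟨0, hP.zero_mem, 1, IsSumSq.one, by ring⟩)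
    rw [map_neg] at h₂
    linarith
  obtain ⟨c, hc⟩ := harch s
  obtain ⟨d, hd⟩ := harch (s ^ 2 * f + 1)
  obtain ⟨k, hk, hck, hdk⟩ : ∃ k : ℝ, 0 < k ∧ c ≤ 2 * k ∧ d ≤ 2 * k :=
    ⟨|c| + |d| + 1, by positivity, by linarith [le_abs_self c, abs_nonneg c, abs_nonneg d],
      by linarith [le_abs_self d, abs_nonneg c, abs_nonneg d]⟩
  have mono : ∀ {a : A} {x y : ℝ}, x ≤ y → algebraMap ℝ A x - a ∈ P →
      algebraMap ℝ A y - a ∈ P := by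
    intro a x y hxy h
    convert hP.add_mem h (hP.algebraMap_mem (sub_nonneg.2 hxy)) using 1
    rw [map_sub]
    ring
  have hs₁ := mono hck hc
  have hs₂ := mono hdk hd
  have step : ∀ r : ℝ, 0 ≤ r → f + algebraMap ℝ A r ∈ P →
      f + algebraMap ℝ A (r - 1 / k ^ 2) ∈ P := by
    intro r hr h
    refine hP.mem_of_algebraMap_mul_mem (c := k ^ 2) (by positivity) ?_
    have e : algebraMap ℝ A (k ^ 2) * (f + algebraMap ℝ A (r - 1 / k ^ 2)) =
        algebraMap ℝ A k ^ 2 * f + algebraMap ℝ A k ^ 2 * algebraMap ℝ A r - 1 := by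
      rw [mul_add, ← map_mul, show k ^ 2 * (r - 1 / k ^ 2) = k ^ 2 * r - 1 by field_simp]
      simp only [map_mul, map_pow, map_sub, map_one]
      ring
    rw [e]
    have h₁ := hP.sq_mul_mem (algebraMap ℝ A k - s) h
    have h₂ := hP.algebraMap_mul_mem (c := 2 * k) (by positivity) hq
    have h₃ := hP.algebraMap_mul_mem hr (hP.isSumSq_mul_mem hs hs₁)
    convert hP.add_mem (hP.add_mem h₁ h₂) (hP.add_mem h₃ hs₂) using 1
    simp only [map_mul, map_ofNat]
    linear_combination (2 * algebraMap ℝ A k) * hqs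
  obtain ⟨r, hr⟩ := harch (-f)
  have main : ∀ (j : ℕ) (t : ℝ), t ≤ j * (1 / k ^ 2) → f + algebraMap ℝ A t ∈ P → f ∈ P := by
    intro j
    have of_nonpos : ∀ t : ℝ, t ≤ 0 → f + algebraMap ℝ A t ∈ P → f ∈ P := by
      intro t ht h
      convert hP.add_mem h (hP.algebraMap_mem (neg_nonneg.2 ht)) using 1
      rw [map_neg]
      ring
    induction j with
    | zero =>
      intro t ht
      exact of_nonpos t (by simpa using ht)
    | succ j ih =>
      intro t ht h
      rcases le_total t 0 with h0 | h0
      · exact of_nonpos t h0 h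
      · refine ih _ ?_ (step t h0 h)
        push_cast at ht
        linarith
  obtain ⟨j, hj⟩ := exists_nat_ge (r * k ^ 2)
  refine main j r ?_ ?_
  · rw [mul_one_div, le_div_iff₀ (by positivity)]
    exact hj
  · rwa [sub_neg_eq_add, add_comm] at hr

/-- If `P` bounds the square of every variable, then it is Archimedean. -/
lemma archimedean_of_X_sq {σ : Type*} {P : Set (MvPolynomial σ ℝ)} (hP : IsQuadModule P)
    (hX : ∀ i, ∃ c : ℝ, algebraMap ℝ (MvPolynomial σ ℝ) c - X i ^ 2 ∈ P)
    (p : MvPolynomial σ ℝ) : ∃ c : ℝ, algebraMap ℝ (MvPolynomial σ ℝ) c - p ∈ P := by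
  let bdd : MvPolynomial σ ℝ → Prop := fun a => ∃ c : ℝ, 0 < c ∧
    algebraMap ℝ (MvPolynomial σ ℝ) c - a ∈ P ∧ algebraMap ℝ (MvPolynomial σ ℝ) c + a ∈ P
  have bdd_add : ∀ a b, bdd a → bdd b → bdd (a + b) := by
    rintro a b ⟨c, hc, h₁, h₂⟩ ⟨d, hd, h₃, h₄⟩
    refine ⟨c + d, by positivity, ?_, ?_⟩
    · convert hP.add_mem h₁ h₃ using 1
      rw [map_add]
      ring
    · convert hP.add_mem h₂ h₄ using 1
      rw [map_add]
      ring
  have bdd_neg : ∀ a, bdd a → bdd (-a) := by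
    rintro a ⟨c, hc, h₁, h₂⟩
    exact ⟨c, hc, by simpa using h₂, by simpa [sub_eq_add_neg] using h₁⟩
  have bdd_sq : ∀ a, bdd a → bdd (a ^ 2) := by
    rintro a ⟨c, hc, h₁, h₂⟩
    exact ⟨c ^ 2, by positivity, hP.sq_sub_sq_mem hc h₁ h₂,
      hP.add_mem (hP.algebraMap_mem (by positivity)) (hP.sq_mem a)⟩
  have bdd_smul : ∀ (r : ℝ) a, 0 < r → bdd a → bdd (algebraMap ℝ _ r * a) := by
    rintro r a hr ⟨c, hc, h₁, h₂⟩
    refine ⟨r * c, by positivity, ?_, ?_⟩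
    · rw [map_mul, ← mul_sub]
      exact hP.algebraMap_mul_mem hr.le h₁
    · rw [map_mul, ← mul_add]
      exact hP.algebraMap_mul_mem hr.le h₂
  have bdd_mul : ∀ a b, bdd a → bdd b → bdd (a * b) := by
    intro a b ha hb
    have h := bdd_smul (1 / 4) _ (by norm_num) (bdd_add _ _ (bdd_sq _ (bdd_add _ _ ha hb))
      (bdd_neg _ (bdd_sq _ (bdd_add _ _ ha (bdd_neg _ hb)))))
    convert h using 1
    have : algebraMap ℝ (MvPolynomial σ ℝ) (1 / 4) * 4 = 1 := by
      rw [← map_ofNat (algebraMap ℝ (MvPolynomial σ ℝ)) 4, ← map_mul]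
      norm_num
    linear_combination (-a * b) * this
  have bdd_X : ∀ i, bdd (X i) := by
    intro i
    obtain ⟨c, hc⟩ := hX i
    have half : algebraMap ℝ (MvPolynomial σ ℝ) (1 / 2) * 2 = 1 := by
      rw [← map_ofNat (algebraMap ℝ (MvPolynomial σ ℝ)) 2, ← map_mul]
      norm_num
    have key : ∀ e : MvPolynomial σ ℝ, e ^ 2 = 1 →
        algebraMap ℝ (MvPolynomial σ ℝ) (|c| + 1) - e * X i ∈ P := by
      intro e he
      have h := hP.add_mem (hP.add_mem hc
        (hP.sq_mem (X i - e * algebraMap ℝ (MvPolynomial σ ℝ) (1 / 2))))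
        (hP.algebraMap_mem (c := |c| + 1 - c - (1 / 2) ^ 2) (by linarith [le_abs_self c]))
      convert h using 1
      simp only [map_add, map_sub, map_pow, map_one]
      linear_combination (e * X i) * half - (algebraMap ℝ (MvPolynomial σ ℝ) (1 / 2)) ^ 2 * he
    refine ⟨|c| + 1, by positivity, by simpa using key 1 (by ring), ?_⟩
    simpa using key (-1) (by ring)
  have hall : bdd p := by
    induction p using MvPolynomial.induction_on with
    | C r =>
      refine ⟨|r| + 1, by positivity, ?_, ?_⟩
      · change _ - algebraMap ℝ (MvPolynomial σ ℝ) r ∈ P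
        rw [← map_sub]
        exact hP.algebraMap_mem (by linarith [le_abs_self r])
      · change _ + algebraMap ℝ (MvPolynomial σ ℝ) r ∈ P
        rw [← map_add]
        exact hP.algebraMap_mem (by linarith [neg_abs_le r])
    | add a b ha hb => exact bdd_add a b ha hb
    | mul_X a i ha => exact bdd_mul a _ ha (bdd_X i)
  obtain ⟨c, -, hc, -⟩ := hall
  exact ⟨c, hc⟩

end IsQuadModule

section QuadraticModule

variable {σ τ ιg ιh : Type*}

lemma IsSOS.zero : IsSOS (0 : MvPolynomial σ ℝ) := ⟨0, Fin.elim0, by simp⟩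

lemma IsSOS.sq (p : MvPolynomial σ ℝ) : IsSOS (p ^ 2) := ⟨1, fun _ => p, by simp⟩

lemma IsSOS.add {p q : MvPolynomial σ ℝ} (hp : IsSOS p) (hq : IsSOS q) : IsSOS (p + q) := by
  obtain ⟨k, a, rfl⟩ := hp
  obtain ⟨l, b, rfl⟩ := hq
  exact ⟨k + l, Fin.append a b, by simp [Fin.sum_univ_add]⟩

lemma IsSOS.sq_mul {p : MvPolynomial σ ℝ} (a : MvPolynomial σ ℝ) (hp : IsSOS p) :
    IsSOS (a ^ 2 * p) := by
  obtain ⟨k, b, rfl⟩ := hp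
  exact ⟨k, fun i => a * b i, by simp only [mul_pow, Finset.mul_sum]⟩

lemma IsSOS.rename {p : MvPolynomial σ ℝ} (e : σ → τ) (hp : IsSOS p) :
    IsSOS (MvPolynomial.rename e p) := by
  obtain ⟨k, b, rfl⟩ := hp
  exact ⟨k, fun i => MvPolynomial.rename e (b i), by simp⟩

lemma IsSOS.eval_nonneg {p : MvPolynomial σ ℝ} (hp : IsSOS p) (z : σ → ℝ) : 0 ≤ eval z p := by
  obtain ⟨k, b, rfl⟩ := hp
  simp only [map_sum, map_pow]
  positivity

variable [Fintype ιg] [Fintype ιh] {g : ιg → MvPolynomial σ ℝ} {h : ιh → MvPolynomial σ ℝ}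

variable (g h) in
lemma isQuadModule_inQM : IsQuadModule {p | InQM g h p} where
  one_mem := ⟨1, 0, 0, by simpa using IsSOS.sq (1 : MvPolynomial σ ℝ), fun _ => .zero, by simp⟩
  add_mem := by
    rintro _ _ ⟨s0, s, q, h0, hs, rfl⟩ ⟨t0, t, r, k0, ht, rfl⟩
    refine ⟨s0 + t0, s + t, q + r, h0.add k0, fun j => (hs j).add (ht j), ?_⟩
    simp only [Pi.add_apply, mul_add, Finset.sum_add_distrib]
    ring
  sq_mul_mem := by
    rintro a _ ⟨s0, s, q, h0, hs, rfl⟩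
    refine ⟨a ^ 2 * s0, fun j => a ^ 2 * s j, fun j => a ^ 2 * q j, h0.sq_mul a,
      fun j => (hs j).sq_mul a, ?_⟩
    simp only [mul_add, Finset.mul_sum, mul_left_comm]

variable (g h) in
lemma inQM_ineq (j : ιg) : InQM g h (g j) := by
  classical
  refine ⟨0, Pi.single j 1, 0, .zero, fun i => ?_, ?_⟩
  · rcases eq_or_ne i j with rfl | hij
    · simpa using IsSOS.sq (1 : MvPolynomial σ ℝ)
    · simpa [hij] using IsSOS.zero
  · simp [Pi.single_apply]

variable (g h) in
lemma inQM_eq_mul (j : ιh) (p : MvPolynomial σ ℝ) : InQM g h (h j * p) := by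
  classical
  exact ⟨0, 0, Pi.single j p, .zero, fun _ => .zero, by simp [Pi.single_apply]⟩

lemma InQMdeg.inQM {ℓ : ℕ} {p : MvPolynomial σ ℝ} (hp : InQMdeg ℓ g h p) : InQM g h p := by
  obtain ⟨s0, s, q, h0, hs, -, -, -, rfl⟩ := hp
  exact ⟨s0, s, q, h0, hs, rfl⟩

lemma InQM.exists_inQMdeg {p : MvPolynomial σ ℝ} (hp : InQM g h p) :
    ∃ ℓ₀ : ℕ, ∀ ℓ, ℓ₀ ≤ ℓ → InQMdeg ℓ g h p := by
  obtain ⟨s0, s, q, h0, hs, rfl⟩ := hp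
  refine ⟨s0.totalDegree + ∑ j, (s j).totalDegree + ∑ j, (q j).totalDegree, fun ℓ hℓ =>
    ⟨s0, s, q, h0, hs, by omega, fun j => ?_, fun j => ?_, rfl⟩⟩
  · have := Finset.single_le_sum (f := fun j => (s j).totalDegree) (fun _ _ => Nat.zero_le _)
      (Finset.mem_univ j)
    omega
  · have := Finset.single_le_sum (f := fun j => (q j).totalDegree) (fun _ _ => Nat.zero_le _)
      (Finset.mem_univ j)
    omega

lemma InQM.eval_nonneg {p : MvPolynomial σ ℝ} (hp : InQM g h p) {z : σ → ℝ}
    (hg : ∀ j, 0 ≤ eval z (g j)) (hh : ∀ j, eval z (h j) = 0) : 0 ≤ eval z p := by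
  obtain ⟨s0, s, q, h0, hs, rfl⟩ := hp
  simp only [map_add, map_sum, map_mul, hh, zero_mul, Finset.sum_const_zero, add_zero]
  exact add_nonneg (h0.eval_nonneg z)
    (Finset.sum_nonneg fun j _ => mul_nonneg (hg j) ((hs j).eval_nonneg z))

end QuadraticModule

lemma InQM.lift {m : ℕ} {ιg ιh τ : Type*} [Fintype ιg] [Fintype ιh] [Fintype τ]
    {g : ιg → MvPolynomial (Fin m) ℝ} {h : ιh → MvPolynomial (Fin m) ℝ}
    {p : MvPolynomial (Fin m) ℝ} (hp : InQM g h p) :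
    InQM (liftIneq τ g) (liftEq τ h) (rename Sum.inl p) := by
  obtain ⟨s0, s, q, h0, hs, rfl⟩ := hp
  refine ⟨rename Sum.inl s0, fun j => rename Sum.inl (s j),
    Sum.elim (fun j => rename Sum.inl (q j)) 0, h0.rename _, fun j => (hs j).rename _, ?_⟩
  simp [liftIneq, liftEq]

lemma eval_sjFormPoly {m n : ℕ} (π : Fin m → Fin n) (u : Fin n → MvPolynomial (Fin m) ℝ)
    (z : Fin m ⊕ Fin m → ℝ) :
    eval z (sjFormPoly π u) = sjForm π u (z ∘ Sum.inl) (z ∘ Sum.inr) := by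
  simp [sjFormPoly, sjForm, eval_rename]

lemma IsQuadModule.sub_sq_mem {A κ : Type*} [CommRing A] {P : Set A} (hP : IsQuadModule P)
    [Fintype κ] {a : κ → A} {b : A} (hb : b - ∑ j, a j ^ 2 ∈ P) (i : κ) : b - a i ^ 2 ∈ P := by
  classical
  have hsum : IsSumSq (∑ j ∈ Finset.univ.erase i, a j ^ 2) :=
    IsSumSq.sum fun j _ => by
      rw [sq]
      exact IsSumSq.mul_self _
  have := hP.add_mem hb (hP.isSumSq_mem hsum)
  rw [← Finset.add_sum_erase _ _ (Finset.mem_univ i)] at this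
  convert this using 1
  ring

/-- **Putinar's Positivstellensatz** on the product of `X` with a sphere. -/
theorem inQM_lift_of_pos {m : ℕ} {ιg ιh τ : Type*} [Fintype ιg] [Fintype ιh] [Fintype τ]
    (g : ιg → MvPolynomial (Fin m) ℝ) (h : ιh → MvPolynomial (Fin m) ℝ)
    (hArch : ∃ N : ℕ, InQM g h (C (N : ℝ) - ∑ i, X i ^ 2))
    {f : MvPolynomial (Fin m ⊕ τ) ℝ}
    (hf : ∀ z : Fin m ⊕ τ → ℝ, z ∘ Sum.inl ∈ semialgSet g h →
      ∑ t, z (Sum.inr t) ^ 2 = 1 → 0 < eval z f) :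
    InQM (liftIneq τ g) (liftEq τ h) f := by
  have hQ := isQuadModule_inQM (liftIneq τ g) (liftEq τ h)
  refine hQ.mem_of_forall_algHom_pos (hQ.archimedean_of_X_sq ?_) fun φ hφ => ?_
  · rintro (i | t)
    · obtain ⟨N, hN⟩ := hArch
      refine ⟨N, hQ.sub_sq_mem (a := fun i => X (Sum.inl i)) ?_ i⟩
      have := hN.lift (τ := τ)
      simp only [map_sub, map_sum, map_pow, rename_X, rename_C] at this
      exact this
    · refine ⟨1, hQ.sub_sq_mem (a := fun t => X (Sum.inr t)) ?_ t⟩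
      have := inQM_eq_mul (liftIneq τ g) (liftEq τ h) (Sum.inr ()) 1
      rw [mul_one] at this
      rw [map_one]
      exact this
  · let z : Fin m ⊕ τ → ℝ := fun i => φ (X i)
    have hz : ∀ p, φ p = eval z p := fun p => by
      rw [← MvPolynomial.coe_aeval_eq_eval]
      exact DFunLike.congr_fun (MvPolynomial.algHom_ext (by simp [z]) : φ = aeval z) p
    have heq : ∀ j, eval z (liftEq τ h j) = 0 := by
      intro j
      have h₁ := hφ _ (inQM_eq_mul (liftIneq τ g) (liftEq τ h) j 1)
      have h₂ := hφ _ (inQM_eq_mul (liftIneq τ g) (liftEq τ h) j (-1))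
      rw [hz] at h₁ h₂
      simp only [map_mul, map_neg, map_one] at h₁ h₂
      linarith
    rw [hz]
    refine hf z ⟨fun j => ?_, fun j => ?_⟩ ?_
    · have := hφ _ (inQM_ineq (liftIneq τ g) (liftEq τ h) j)
      rwa [hz, liftIneq, eval_rename] at this
    · have := heq (Sum.inl j)
      rwa [liftEq, Sum.elim_inl, eval_rename] at this
    · have := heq (Sum.inr ())
      simp only [liftEq, Sum.elim_inr, map_sub, map_one, map_sum, map_pow, eval_X] at this
      linarith

/-- If `Q(X)` is Archimedean (and `X` is compact), and `M*` is the maximum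
of `yᵀ SJ(x) y` over `x ∈ X` and `yᵀy = 1`, then the SOS hierarchy values `Λ_ℓ(G)`
converge to `M*`: for every `ε > 0` there is `ℓ₀` with `M* ≤ Λ_ℓ(G) ≤ M* + ε` for all
`ℓ ≥ ℓ₀`. -/
theorem sos_hierarchy_converges_to_max_eigenvalue {m n mg mh : ℕ}
    (π : Fin m → Fin n) (u : Fin n → MvPolynomial (Fin m) ℝ)
    (g : Fin mg → MvPolynomial (Fin m) ℝ) (h : Fin mh → MvPolynomial (Fin m) ℝ)
    (hX : IsCompact (semialgSet g h))
    (hArch : ∃ N : ℕ, InQM g h (C (N : ℝ) - ∑ i, X i ^ 2))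
    (Mstar : ℝ)
    (hM : IsGreatest {r : ℝ | ∃ x ∈ semialgSet g h, ∃ y : Fin m → ℝ,
        (∑ i, y i ^ 2) = 1 ∧ r = sjForm π u x y} Mstar) :
    ∀ ε : ℝ, 0 < ε → ∃ ℓ₀ : ℕ, ∀ ℓ : ℕ, ℓ₀ ≤ ℓ →
      (Mstar : EReal) ≤ LambdaVal π u g h ℓ ∧
        LambdaVal π u g h ℓ ≤ ((Mstar + ε : ℝ) : EReal) := by
  intro ε hε
  have hmem : InQM (liftIneq (Fin m) g) (liftEq (Fin m) h) (C (Mstar + ε) - sjFormPoly π u) := by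
    refine inQM_lift_of_pos g h hArch fun z hz hz1 => ?_
    have := hM.2 ⟨_, hz, z ∘ Sum.inr, hz1, rfl⟩
    rw [map_sub, eval_C, eval_sjFormPoly]
    linarith
  obtain ⟨ℓ₀, hℓ₀⟩ := hmem.exists_inQMdeg
  refine ⟨ℓ₀, fun ℓ hℓ => ⟨le_sInf ?_, sInf_le ⟨_, rfl, hℓ₀ ℓ hℓ⟩⟩⟩
  rintro _ ⟨lam, rfl, hlam⟩
  obtain ⟨x, hx, y, hy, hxy⟩ := hM.1
  have := hlam.inQM.eval_nonneg (z := Sum.elim x y)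
    (fun j => by simpa [liftIneq, eval_rename] using hx.1 j)
    (by
      rintro (j | j)
      · simpa [liftEq, eval_rename] using hx.2 j
      · simp [liftEq, hy])
  rw [map_sub, eval_C, eval_sjFormPoly, Sum.elim_comp_inl, Sum.elim_comp_inr, ← hxy] at this
  exact EReal.coe_le_coe_iff.2 (by linarith)

end
end

section
/- Fix n, d ∈ ℕ and a set X ⊆ ℝ^m, identify degree-d n-player polynomial games over X with their coefficient vectors in ℝ^M, and let M = {G ∈ ℝ^M : SJ_G(x) ⪯ 0 for all x ∈ X} and S = {G ∈ ℝ^M : SJ_G(x) ≺ 0 for all x ∈ X} be the sets of monotone and strictly monotone games. If S is nonempty, then the topological interior of M in ℝ^M is contained in S. -/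
open MvPolynomial Finset

noncomputable section

/-- Index set for the monomials of total degree at most `d` in `m` variables: exponent
tuples `e` with `Σ_j e j ≤ d`. -/
abbrev ExpIdx (m d : ℕ) : Type :=
  {e : Fin m → Fin (d + 1) // (∑ j, ((e j : ℕ))) ≤ d}

/-- The polynomial of total degree at most `d` with coefficient vector `c`; this realizes
the identification of degree-`d` payoffs with coefficient vectors in `ℝ^M`. -/
def payoffOf {m : ℕ} (d : ℕ) (c : ExpIdx m d → ℝ) : MvPolynomial (Fin m) ℝ :=
  ∑ e : ExpIdx m d, C (c e) * ∏ j, X j ^ ((e.1 j : ℕ))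

theorem payoffOf_add {m : ℕ} (d : ℕ) (c c' : ExpIdx m d → ℝ) :
    payoffOf d (c + c') = payoffOf d c + payoffOf d c' := by
  simp only [payoffOf, Pi.add_apply, C_add, add_mul, sum_add_distrib]

theorem payoffOf_smul {m : ℕ} (d : ℕ) (r : ℝ) (c : ExpIdx m d → ℝ) :
    payoffOf d (r • c) = C r * payoffOf d c := by
  simp only [payoffOf, Pi.smul_apply, smul_eq_mul, C_mul, mul_assoc, mul_sum]

/-- The quadratic form of the symmetrized Jacobian is linear in the coefficient vector. -/
theorem sjForm_payoffOf_linear_combination {m n : ℕ} (d : ℕ) (π : Fin m → Fin n)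
    (a b : ℝ) (c s : Fin n → ExpIdx m d → ℝ) (x y : Fin m → ℝ) :
    sjForm π (fun i => payoffOf d ((a • c + b • s) i)) x y =
      a * sjForm π (fun i => payoffOf d (c i)) x y +
        b * sjForm π (fun i => payoffOf d (s i)) x y := by
  simp only [sjForm, mul_sum, ← sum_add_distrib]
  refine sum_congr rfl fun j _ => sum_congr rfl fun k _ => ?_
  simp only [sjac, pseudoGrad, Pi.add_apply, Pi.smul_apply, payoffOf_add, payoffOf_smul,
    map_add, map_mul, pderiv_C_mul, eval_C]
  ring

/-- Identifying degree-`d` `n`-player polynomial games over `X` with their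
coefficient vectors, let `M` be the set of monotone games (`SJ_G(x) ⪯ 0` on `X`) and `S`
the set of strictly monotone games (`SJ_G(x) ≺ 0` on `X`). If `S` is nonempty, then the
topological interior of `M` is contained in `S`. -/
theorem interior_of_monotone_games_subset_strictly_monotone {m n : ℕ} (d : ℕ)
    (π : Fin m → Fin n) (X : Set (Fin m → ℝ))
    (hS : {c : Fin n → ExpIdx m d → ℝ |
        ∀ x ∈ X, ∀ y : Fin m → ℝ, y ≠ 0 →
          sjForm π (fun i => payoffOf d (c i)) x y < 0}.Nonempty) :
    interior {c : Fin n → ExpIdx m d → ℝ |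
        ∀ x ∈ X, ∀ y : Fin m → ℝ, sjForm π (fun i => payoffOf d (c i)) x y ≤ 0} ⊆
      {c : Fin n → ExpIdx m d → ℝ |
        ∀ x ∈ X, ∀ y : Fin m → ℝ, y ≠ 0 →
          sjForm π (fun i => payoffOf d (c i)) x y < 0} := by
  obtain ⟨s, hs⟩ := hS
  intro c hc x hx y hy
  have hcont : Continuous fun t : ℝ => (1 + t) • c + (-t) • s := by fun_prop
  have hlim := hcont.tendsto 0
  simp only [add_zero, one_smul, neg_zero, zero_smul] at hlim
  have hnear := hlim.eventually (mem_interior_iff_mem_nhds.mp hc)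
  obtain ⟨t, ht, ht0⟩ :=
    ((hnear.filter_mono nhdsWithin_le_nhds).and (self_mem_nhdsWithin (s := Set.Ioi 0))).exists
  have ht0 : 0 < t := ht0
  have hle := ht x hx y
  rw [sjForm_payoffOf_linear_combination] at hle
  have hlt := hs x hx y hy
  nlinarith [mul_neg_of_pos_of_neg ht0 hlt]

end
end

section
/- Fix n ∈ ℕ, d ≥ 2, and a compact basic semialgebraic set X ⊆ ℝ^m. Identifying degree-d n-player polynomial games over X with their coefficient vectors in ℝ^M, the set of games that are monotone over X (SJ_G(x) ⪯ 0 for all x ∈ X) but not strictly monotone over X (not SJ_G(x) ≺ 0 for all x ∈ X) has Lebesgue measure zero in ℝ^M. -/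
open MvPolynomial Finset

noncomputable section

lemma payoffOf_add_smul {m : ℕ} (d : ℕ) (a b : ℝ) (c c' : ExpIdx m d → ℝ) :
    payoffOf d (a • c + b • c') = C a * payoffOf d c + C b * payoffOf d c' := by
  simp only [payoffOf, Pi.add_apply, Pi.smul_apply, smul_eq_mul, map_add, map_mul, Finset.mul_sum,
    ← Finset.sum_add_distrib]
  exact Finset.sum_congr rfl fun _ _ => by ring

lemma sjForm_payoffOf_add_smul {m n : ℕ} (d : ℕ) (π : Fin m → Fin n) (a b : ℝ)
    (c c' : Fin n → ExpIdx m d → ℝ) (x y : Fin m → ℝ) :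
    sjForm π (fun i => payoffOf d ((a • c + b • c') i)) x y =
      a * sjForm π (fun i => payoffOf d (c i)) x y +
        b * sjForm π (fun i => payoffOf d (c' i)) x y := by
  have hcomb (i : Fin n) : payoffOf d ((a • c + b • c') i) =
      C a * payoffOf d (c i) + C b * payoffOf d (c' i) :=
    payoffOf_add_smul d a b (c i) (c' i)
  simp only [sjForm, sjac, pseudoGrad, hcomb, map_add, pderiv_C_mul, map_mul, eval_C,
    Finset.mul_sum, ← Finset.sum_add_distrib]
  exact Finset.sum_congr rfl fun _ _ => Finset.sum_congr rfl fun _ _ => by ring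

/-- The exponent index of the monomial `X j ^ 2`. -/
def sqIdx {m d : ℕ} (hd : 2 ≤ d) (j : Fin m) : ExpIdx m d :=
  ⟨fun k => if k = j then ⟨2, by omega⟩ else 0, by simpa [apply_ite Fin.val] using hd⟩

/-- The coefficient vector of the polynomial `∑ j, X j ^ 2 / 2`. -/
def halfSqCoeff {m d : ℕ} (hd : 2 ≤ d) (e : ExpIdx m d) : ℝ :=
  ∑ j, if e = sqIdx hd j then 1 / 2 else 0

lemma payoffOf_halfSqCoeff {m d : ℕ} (hd : 2 ≤ d) :
    payoffOf d (halfSqCoeff (m := m) hd) = ∑ j, C (1 / 2 : ℝ) * X j ^ 2 := by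
  simp only [payoffOf, halfSqCoeff, map_sum, Finset.sum_mul]
  rw [Finset.sum_comm]
  refine Finset.sum_congr rfl fun j _ => ?_
  rw [Finset.sum_eq_single (sqIdx hd j) (fun e _ he => by simp [he]) (by simp), if_pos rfl,
    Finset.prod_eq_single j (fun k _ hk => by simp [sqIdx, hk]) (by simp)]
  simp [sqIdx]

lemma sjForm_halfSqCoeff {m n d : ℕ} (hd : 2 ≤ d) (π : Fin m → Fin n) (x y : Fin m → ℝ) :
    sjForm π (fun _ => payoffOf d (halfSqCoeff hd)) x y = ∑ j, y j ^ 2 := by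
  have hgrad (j : Fin m) :
      pseudoGrad π (fun _ => payoffOf d (halfSqCoeff hd)) j = X j := by
    simp only [pseudoGrad, payoffOf_halfSqCoeff, map_sum, pderiv_C_mul, Derivation.leibniz_pow,
      pderiv_X]
    rw [Finset.sum_eq_single j (fun k _ hk => by simp [hk]) (by simp)]
    rw [Pi.single_eq_same, smul_eq_mul, mul_one, nsmul_eq_mul, ← C_eq_coe_nat, ← mul_assoc,
      ← C_mul]
    simp
  simp only [sjForm, sjac, hgrad, pderiv_X, map_mul, eval_C, map_add]
  refine Finset.sum_congr rfl fun j _ => ?_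
  rw [Finset.sum_eq_single j (fun k _ hk => by simp [hk, hk.symm]) (by simp)]
  simp only [Pi.single_eq_same, map_one]
  ring

/-- The coefficient vectors of the games that are monotone over `S` form a convex set. -/
lemma convex_monotone_games {m n : ℕ} (d : ℕ) (π : Fin m → Fin n) (S : Set (Fin m → ℝ)) :
    Convex ℝ {c : Fin n → ExpIdx m d → ℝ |
      ∀ x ∈ S, ∀ y : Fin m → ℝ, sjForm π (fun i => payoffOf d (c i)) x y ≤ 0} := by
  intro c hc c' hc' a b ha hb _ x hx y
  rw [sjForm_payoffOf_add_smul]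
  nlinarith [mul_nonneg ha (neg_nonneg.2 (hc x hx y)), mul_nonneg hb (neg_nonneg.2 (hc' x hx y))]

/-- Games in the interior of the set of monotone games are strictly monotone. -/
lemma sjForm_neg_of_mem_interior {m n d : ℕ} (hd : 2 ≤ d) (π : Fin m → Fin n)
    (S : Set (Fin m → ℝ)) {c : Fin n → ExpIdx m d → ℝ}
    (hc : c ∈ interior {c : Fin n → ExpIdx m d → ℝ |
      ∀ x ∈ S, ∀ y : Fin m → ℝ, sjForm π (fun i => payoffOf d (c i)) x y ≤ 0})
    {x : Fin m → ℝ} (hx : x ∈ S) {y : Fin m → ℝ} (hy : y ≠ 0) :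
    sjForm π (fun i => payoffOf d (c i)) x y < 0 := by
  have hcont : ContinuousAt
      (fun t : ℝ => (1 : ℝ) • c + t • fun _ : Fin n => halfSqCoeff (m := m) hd) 0 := by
    fun_prop
  have hmem := hcont.preimage_mem_nhds (by simpa using mem_interior_iff_mem_nhds.1 hc)
  obtain ⟨t, ht, htpos⟩ :=
    Filter.nonempty_of_mem (Filter.inter_mem (nhdsWithin_le_nhds hmem)
      (self_mem_nhdsWithin (s := Set.Ioi (0 : ℝ))))
  have hle : sjForm π (fun i => payoffOf d
      (((1 : ℝ) • c + t • fun _ : Fin n => halfSqCoeff (m := m) hd) i)) x y ≤ 0 := ht x hx y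
  rw [sjForm_payoffOf_add_smul, sjForm_halfSqCoeff] at hle
  obtain ⟨j, hj⟩ := Function.ne_iff.1 hy
  have hsq : 0 < ∑ j, y j ^ 2 :=
    Finset.sum_pos' (fun _ _ => sq_nonneg _) ⟨j, Finset.mem_univ j, sq_pos_of_ne_zero hj⟩
  have := mul_pos (Set.mem_Ioi.1 htpos) hsq
  linarith

open MeasureTheory in
/-- For `d ≥ 2` and a compact basic semialgebraic set `X`, identifying
degree-`d` `n`-player polynomial games over `X` with their coefficient vectors, the set of
games that are monotone over `X` but not strictly monotone over `X` has Lebesgue measure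
zero in the coefficient space. -/
theorem monotone_not_strictly_monotone_measure_zero {m n mg mh : ℕ} (d : ℕ) (hd : 2 ≤ d)
    (π : Fin m → Fin n)
    (g : Fin mg → MvPolynomial (Fin m) ℝ) (h : Fin mh → MvPolynomial (Fin m) ℝ)
    (hX : IsCompact (semialgSet g h)) :
    volume {c : Fin n → ExpIdx m d → ℝ |
      (∀ x ∈ semialgSet g h, ∀ y : Fin m → ℝ,
          sjForm π (fun i => payoffOf d (c i)) x y ≤ 0) ∧
      ¬ (∀ x ∈ semialgSet g h, ∀ y : Fin m → ℝ, y ≠ 0 →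
          sjForm π (fun i => payoffOf d (c i)) x y < 0)} = 0 := by
  refine measure_mono_null ?_ ((convex_monotone_games d π (semialgSet g h)).addHaar_frontier volume)
  rintro c ⟨hmono, hstrict⟩
  exact ⟨subset_closure hmono, fun hint =>
    hstrict fun _ hx _ hy => sjForm_neg_of_mem_interior hd π _ hint hx hy⟩

end
end

section
/- Let X_i ⊆ ℝ^{m_i} be nonempty convex sets for i = 1,…,n and X = X_1 × ⋯ × X_n. Let u_1,…,u_n : ℝ^m → ℝ be differentiable functions such that for each i and each fixed x_{−i}, the map x_i ↦ u_i(x_i, x_{−i}) is concave on X_i, and let v(x) = (∇_{x_1}u_1(x),…,∇_{x_n}u_n(x)). If the game is diagonally strictly concave, i.e., ⟨v(x) − v(x′), x − x′⟩ < 0 for all x, x′ ∈ X with x ≠ x′, then the game has at most one Nash equilibrium: there is at most one point x* ∈ X such that u_i(x*) ≥ u_i(x_i, x*_{−i}) for every player i and every x_i ∈ X_i. -/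
open Finset


/-- The derivative of a function at a maximizer over a convex set is nonpositive in every
direction pointing into the set. -/
lemma IsMaxOn.fderiv_sub_nonpos {E : Type*} [NormedAddCommGroup E] [NormedSpace ℝ E]
    {f : E → ℝ} {s : Set E} {x y : E} (hmax : IsMaxOn f s x) (hs : Convex ℝ s)
    (hf : DifferentiableAt ℝ f x) (hx : x ∈ s) (hy : y ∈ s) :
    fderiv ℝ f x (y - x) ≤ 0 :=
  hmax.localize.hasFDerivWithinAt_nonpos hf.hasFDerivAt.hasFDerivWithinAt
    (sub_mem_posTangentConeAt_of_segment_subset (hs.segment_subset hx hy))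

/-- At a point where no player gains by a unilateral deviation, each player's own derivative is
nonpositive in every feasible direction. -/
lemma fderiv_update_sub_nonpos {ι : Type*} [Fintype ι] [DecidableEq ι] {E : ι → Type*}
    [∀ i, NormedAddCommGroup (E i)] [∀ i, NormedSpace ℝ (E i)] {f : (∀ i, E i) → ℝ}
    (hf : Differentiable ℝ f) {i : ι} {s : Set (E i)} (hs : Convex ℝ s) {x : ∀ i, E i}
    (hx : x i ∈ s) (hmax : ∀ z ∈ s, f (Function.update x i z) ≤ f x) {y : E i} (hy : y ∈ s) :
    fderiv ℝ (fun z => f (Function.update x i z)) (x i) (y - x i) ≤ 0 := by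
  refine IsMaxOn.fderiv_sub_nonpos (isMaxOn_iff.mpr fun z hz => ?_) hs ?_ hx hy
  · simpa using hmax z hz
  · exact hf.differentiableAt.comp (x i) (hasFDerivAt_update x (x i)).differentiableAt

/-- **Rosen.** Let `X_i ⊆ ℝ^{m_i}` be nonempty convex sets, and let the
payoffs `u_i` be differentiable and concave in player `i`'s own block on `X_i` for every
fixed profile of the other players.  If the game is diagonally strictly concave, i.e.
`⟨v(x) − v(x′), x − x′⟩ = Σ_i (∇_i u_i(x) − ∇_i u_i(x′)) · (x_i − x′_i) < 0` for all
distinct `x, x′ ∈ X = Π_i X_i`, then the game has at most one Nash equilibrium. -/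
theorem diagonally_strictly_concave_unique_nash {n : ℕ} (mdim : Fin n → ℕ)
    (Xs : ∀ i, Set (Fin (mdim i) → ℝ))
    (hne : ∀ i, (Xs i).Nonempty) (hconv : ∀ i, Convex ℝ (Xs i))
    (u : Fin n → (∀ i, Fin (mdim i) → ℝ) → ℝ)
    (hdiff : ∀ i, Differentiable ℝ (u i))
    (hconc : ∀ (i : Fin n) (x : ∀ i, Fin (mdim i) → ℝ),
      ConcaveOn ℝ (Xs i) fun z => u i (Function.update x i z))
    (hdsc : ∀ x x' : ∀ i, Fin (mdim i) → ℝ,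
      (∀ i, x i ∈ Xs i) → (∀ i, x' i ∈ Xs i) → x ≠ x' →
      (∑ i, (fderiv ℝ (fun z => u i (Function.update x i z)) (x i) (x i - x' i) -
             fderiv ℝ (fun z => u i (Function.update x' i z)) (x' i) (x i - x' i))) < 0) :
    ∀ a b : ∀ i, Fin (mdim i) → ℝ,
      ((∀ i, a i ∈ Xs i) ∧ ∀ i, ∀ z ∈ Xs i, u i (Function.update a i z) ≤ u i a) →
      ((∀ i, b i ∈ Xs i) ∧ ∀ i, ∀ z ∈ Xs i, u i (Function.update b i z) ≤ u i b) →
      a = b := by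
  rintro a b ⟨ha, hmaxa⟩ ⟨hb, hmaxb⟩
  by_contra hab
  refine (hdsc a b ha hb hab).not_ge (Finset.sum_nonneg fun i _ => ?_)
  have h₁ := fderiv_update_sub_nonpos (hdiff i) (hconv i) (ha i) (hmaxa i) (hb i)
  have h₂ := fderiv_update_sub_nonpos (hdiff i) (hconv i) (hb i) (hmaxb i) (ha i)
  rw [← neg_sub (a i) (b i), map_neg] at h₁
  linarith
end

section
/- Let X_i ⊆ ℝ^{m_i} be convex sets for i = 1,…,n, X = X_1 × ⋯ × X_n, and let u_1,…,u_n : ℝ^m → ℝ be differentiable with pseudogradient v(x) = (∇_{x_1}u_1(x),…,∇_{x_n}u_n(x)). If the game is monotone, i.e., ⟨v(x) − v(x′), x − x′⟩ ≤ 0 for all x, x′ ∈ X, then the game is concave: for every player i and every fixed x_{−i} ∈ X_{−i}, the map x_i ↦ u_i(x_i, x_{−i}) is concave on X_i. -/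
open Finset


/-- A differentiable function whose derivative is a monotone decreasing operator on a convex set
is concave there. -/
theorem concaveOn_of_fderiv_sub_apply_sub_nonpos {E : Type*} [NormedAddCommGroup E]
    [NormedSpace ℝ E] {s : Set E} (hs : Convex ℝ s) {f : E → ℝ} (hf : Differentiable ℝ f)
    (hanti : ∀ a ∈ s, ∀ b ∈ s, fderiv ℝ f a (a - b) - fderiv ℝ f b (a - b) ≤ 0) :
    ConcaveOn ℝ s f := by
  refine ⟨hs, fun a ha b hb p q hp hq hpq ↦ ?_⟩
  have hderiv (t : ℝ) : HasDerivAt (fun t : ℝ ↦ f (AffineMap.lineMap a b t))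
      (fderiv ℝ f (AffineMap.lineMap a b t) (b - a)) t :=
    (hf _).hasFDerivAt.comp_hasDerivAt t AffineMap.hasDerivAt_lineMap
  have hmem {t : ℝ} (ht : t ∈ interior (Set.Icc (0 : ℝ) 1)) : AffineMap.lineMap a b t ∈ s :=
    hs.lineMap_mem ha hb (interior_subset ht)
  have hconc : ConcaveOn ℝ (Set.Icc (0 : ℝ) 1) fun t ↦ f (AffineMap.lineMap a b t) := by
    refine AntitoneOn.concaveOn_of_deriv (convex_Icc 0 1)
      (fun t _ ↦ (hderiv t).continuousAt.continuousWithinAt)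
      (fun t _ ↦ (hderiv t).differentiableAt.differentiableWithinAt) ?_
    intro r hr t ht hrt
    rw [(hderiv r).deriv, (hderiv t).deriv]
    rcases hrt.eq_or_lt with rfl | hlt
    · rfl
    have h := hanti _ (hmem ht) _ (hmem hr)
    have hsub : AffineMap.lineMap a b t - AffineMap.lineMap a b r = (t - r) • (b - a) := by
      simp only [AffineMap.lineMap_apply_module']
      module
    rw [hsub, map_smul, map_smul, smul_eq_mul, smul_eq_mul, ← mul_sub] at h
    exact sub_nonpos.mp (nonpos_of_mul_nonpos_right h (sub_pos.mpr hlt))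
  have h := hconc.2 (Set.left_mem_Icc.mpr zero_le_one) (Set.right_mem_Icc.mpr zero_le_one) hp hq hpq
  obtain rfl : p = 1 - q := by linarith
  simpa [AffineMap.lineMap_apply_module] using h

/-- Let `X_i ⊆ ℝ^{m_i}` be convex sets and `u_i` differentiable payoffs
with pseudogradient pairing `⟨v(x) − v(x′), x − x′⟩ = Σ_i (∇_i u_i(x) − ∇_i u_i(x′)) ·
(x_i − x′_i)`.  If the game is monotone (this pairing is `≤ 0` for all `x, x′ ∈ X`), then
the game is concave: for every player `i` and every fixed profile whose other blocks lie in
their action sets, `x_i ↦ u_i(x_i, x_{−i})` is concave on `X_i`. -/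
theorem monotone_game_is_concave {n : ℕ} (mdim : Fin n → ℕ)
    (Xs : ∀ i, Set (Fin (mdim i) → ℝ))
    (hconv : ∀ i, Convex ℝ (Xs i))
    (u : Fin n → (∀ i, Fin (mdim i) → ℝ) → ℝ)
    (hdiff : ∀ i, Differentiable ℝ (u i))
    (hmono : ∀ x x' : ∀ i, Fin (mdim i) → ℝ,
      (∀ i, x i ∈ Xs i) → (∀ i, x' i ∈ Xs i) →
      (∑ i, (fderiv ℝ (fun z => u i (Function.update x i z)) (x i) (x i - x' i) -
             fderiv ℝ (fun z => u i (Function.update x' i z)) (x' i) (x i - x' i))) ≤ 0) :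
    ∀ (i : Fin n) (x : ∀ i, Fin (mdim i) → ℝ), (∀ j, j ≠ i → x j ∈ Xs j) →
      ConcaveOn ℝ (Xs i) fun z => u i (Function.update x i z) := by
  intro i x hx
  have hupd : Differentiable ℝ (Function.update x i) :=
    fun z ↦ (hasFDerivAt_update x z).differentiableAt
  refine concaveOn_of_fderiv_sub_apply_sub_nonpos (hconv i) ((hdiff i).comp hupd) ?_
  intro a ha b hb
  have hmem {c : Fin (mdim i) → ℝ} (hc : c ∈ Xs i) (j : Fin n) :
      Function.update x i c j ∈ Xs j := by
    rcases eq_or_ne j i with rfl | hj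
    · simpa using hc
    · simpa [hj] using hx j hj
  have h := hmono _ _ (hmem ha) (hmem hb)
  rw [Finset.sum_eq_single i (fun j _ hj ↦ by simp [hj]) (by simp)] at h
  simpa only [Function.update_self, Function.update_idem] using h
end
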